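/- arXiv:1612.07570 — 2 statements merged into one kernel-verified Lean document; each statement's English description precedes it below -/
import Mathlib

section
/- The single-shot distillable purity of a state ρ of rank r in dimension d equals ⌊log₂(d/r)⌋: the largest integer m for which there exist dimensions d₁, d₂ with d·d₂ = 2^m·d₁ and a unital channel Λ with Λ(ρ ⊗ I/d₂) = ψ₂^{⊗m} ⊗ I/d₁ (ψ₂ a pure qubit state) is m = ⌊log₂(d/r)⌋, provided d ≥ 2r. -/
open Matrix BigOperators
open scoped ComplexOrder

noncomputable section

/-- A density matrix: positive semidefinite with unit trace. -/
def IsDensity {n : Type*} [Fintype n] (ρ : Matrix n n ℂ) : Prop :=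
  ρ.PosSemidef ∧ ρ.trace = 1

/-- A quantum channel (CPTP map), given via a Kraus representation. -/
def IsChannel {m n : Type*} [Fintype m] [Fintype n] [DecidableEq m]
    (Λ : Matrix m m ℂ → Matrix n n ℂ) : Prop :=
  ∃ (k : ℕ) (K : Fin k → Matrix n m ℂ),
    (∑ i, (K i)ᴴ * K i) = 1 ∧ ∀ ρ, Λ ρ = ∑ i, K i * ρ * (K i)ᴴ

/-- `m`-fold Kronecker tensor power of a single-qubit (`2×2`) matrix. -/
def kronPow (ψ : Matrix (Fin 2) (Fin 2) ℂ) : (m : ℕ) → Matrix (Fin (2 ^ m)) (Fin (2 ^ m)) ℂ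
  | 0 => 1
  | m + 1 =>
    Matrix.reindex (finProdFinEquiv.trans (finCongr (pow_succ 2 m).symm))
      (finProdFinEquiv.trans (finCongr (pow_succ 2 m).symm))
      (Matrix.kroneckerMap (· * ·) (kronPow ψ m) ψ)

lemma sdp_spectral {d : ℕ} (ρ : Matrix (Fin d) (Fin d) ℂ) (hρ : ρ.PosSemidef) :
    ∃ (U : Matrix (Fin d) (Fin d) ℂ) (p : Fin d → ℝ), U * Uᴴ = 1 ∧ Uᴴ * U = 1 ∧
      ρ = U * diagonal (fun i => (p i : ℂ)) * Uᴴ ∧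
      (Finset.univ.filter (fun i => p i ≠ 0)).card = ρ.rank ∧ (∀ i, 0 ≤ p i) ∧
      ρ.trace = ∑ i, (p i : ℂ) := by
  have h := hρ.isHermitian
  refine ⟨h.eigenvectorUnitary, h.eigenvalues, ?_, ?_, ?_, ?_, ?_, ?_⟩
  · exact Unitary.mul_star_self_of_mem h.eigenvectorUnitary.2
  · exact Unitary.star_mul_self_of_mem h.eigenvectorUnitary.2
  · have := h.spectral_theorem
    rw [Unitary.conjStarAlgAut_apply] at this
    exact this
  · rw [h.rank_eq_card_non_zero_eigs, Fintype.card_subtype]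
  · exact hρ.eigenvalues_nonneg
  · exact h.trace_eq_sum_eigenvalues

lemma sdp_upper {a b : Type*} [Fintype a] [Fintype b] [DecidableEq a] [DecidableEq b] {k : ℕ}
    (K : Fin k → Matrix b a ℂ) (h1 : (∑ i, (K i)ᴴ * K i) = 1) (h2 : (∑ i, K i * (K i)ᴴ) = 1)
    (C G S : Matrix a a ℂ) (P : Matrix b b ℂ) (hP : Pᴴ = P) (hPP : P * P = P) (c : ℂ)
    (hB : ∑ i, K i * (C * Cᴴ) * (K i)ᴴ = c • P)
    (hS : S = C * Cᴴ * G) (hSh : Sᴴ = S) (hSS : S * S = S) : S.trace.re ≤ P.trace.re := by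
  set Q := 1 - P with hQ
  have hQh : Qᴴ = Q := by simp [hQ, hP]
  have hQP : Q * P = 0 := by simp [hQ, sub_mul, hPP]
  have hz : ∑ i, (Q * K i * C) * (Q * K i * C)ᴴ = 0 := by
    have : ∑ i, (Q * K i * C) * (Q * K i * C)ᴴ = Q * (∑ i, K i * (C * Cᴴ) * (K i)ᴴ) * Q := by
      simp only [Finset.mul_sum, Finset.sum_mul, conjTranspose_mul, hQh, Matrix.mul_assoc]
    rw [this, hB]; simp [hQP]
  have hz2 : ∀ i, Q * K i * C = 0 := by
    have ht := congrArg Matrix.trace hz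
    rw [trace_sum, trace_zero, Finset.sum_eq_zero_iff_of_nonneg
      (fun i _ => (posSemidef_self_mul_conjTranspose _).trace_nonneg)] at ht
    intro i
    exact trace_mul_conjTranspose_self_eq_zero_iff.1 (ht i (Finset.mem_univ i))
  have hPK : ∀ i, P * (K i * S) = K i * S := by
    intro i
    have : Q * (K i * S) = 0 := by
      rw [hS, ← Matrix.mul_assoc, ← Matrix.mul_assoc, ← Matrix.mul_assoc, hz2]; simp
    rw [hQ, Matrix.sub_mul, Matrix.one_mul, sub_eq_zero] at this
    exact this.symm
  set X := ∑ i, (K i)ᴴ * P * K i with hX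
  have hXS : X * S = S := by
    calc X * S = (∑ i, (K i)ᴴ * K i) * S := by
          simp only [hX, Finset.sum_mul, Matrix.mul_assoc, hPK]
      _ = S := by rw [h1, Matrix.one_mul]
  have hXh : Xᴴ = X := by
    simp only [hX, conjTranspose_sum, conjTranspose_mul, hP, conjTranspose_conjTranspose,
      Matrix.mul_assoc]
  have hSX : S * X = S := by
    have := congrArg conjTranspose hXS
    rwa [conjTranspose_mul, hSh, hXh] at this
  have hXpsd : X.PosSemidef := by
    apply posSemidef_sum
    intro i _
    have : (K i)ᴴ * P * K i = (P * K i)ᴴ * (P * K i) := by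
      rw [conjTranspose_mul, hP, Matrix.mul_assoc, Matrix.mul_assoc, ← Matrix.mul_assoc P P, hPP]
    rw [this]
    exact posSemidef_conjTranspose_mul_self _
  have hpsd := (hXpsd.conjTranspose_mul_mul_same (1 - S)).trace_nonneg
  have he : (1 - S)ᴴ * X * (1 - S) = X - S := by
    simp [hSh, Matrix.sub_mul, Matrix.mul_sub, hSX, hXS, hSS]
  have htX : X.trace = P.trace := by
    have : X.trace = (P * ∑ i, K i * (K i)ᴴ).trace := by
      simp only [hX, trace_sum, Finset.mul_sum]
      refine Finset.sum_congr rfl fun i _ => ?_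
      rw [Matrix.mul_assoc, Matrix.trace_mul_comm, Matrix.mul_assoc]
    rw [this, h2, Matrix.mul_one]
  rw [he, trace_sub, htX] at hpsd
  have := (Complex.le_def.1 hpsd).1
  simp at this
  exact this

lemma sdp_kronPow (ψ : Fin 2 → ℂ) (h : star ψ ⬝ᵥ ψ = 1) (m : ℕ) :
    (kronPow (vecMulVec ψ (star ψ)) m)ᴴ = kronPow (vecMulVec ψ (star ψ)) m ∧
    kronPow (vecMulVec ψ (star ψ)) m * kronPow (vecMulVec ψ (star ψ)) m
      = kronPow (vecMulVec ψ (star ψ)) m ∧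
    (kronPow (vecMulVec ψ (star ψ)) m).trace = 1 := by
  have v1 : (vecMulVec ψ (star ψ))ᴴ = vecMulVec ψ (star ψ) := by
    simp [conjTranspose_vecMulVec]
  have v2 : vecMulVec ψ (star ψ) * vecMulVec ψ (star ψ) = vecMulVec ψ (star ψ) := by
    rw [vecMulVec_mul_vecMulVec, h]; simp
  have v3 : (vecMulVec ψ (star ψ)).trace = 1 := by
    rw [trace_vecMulVec, dotProduct_comm, h]
  induction m with
  | zero => simp [kronPow]
  | succ m ih =>
    obtain ⟨i1, i2, i3⟩ := ih
    refine ⟨?_, ?_, ?_⟩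
    · rw [kronPow, conjTranspose_reindex, conjTranspose_kronecker, i1, v1]
    · rw [kronPow, reindex_apply, submatrix_mul_equiv, ← mul_kronecker_mul, i2, v2]
    · have hk := trace_kronecker (kronPow (vecMulVec ψ (star ψ)) m) (vecMulVec ψ (star ψ))
      rw [i3, v3, one_mul] at hk
      rw [kronPow, ← hk, reindex_apply]
      simp only [Matrix.trace, diag_apply, submatrix_apply]
      exact Equiv.sum_comp (finProdFinEquiv.trans (finCongr (pow_succ 2 m).symm)).symm
        (fun i => (kroneckerMap (· * ·) (kronPow (vecMulVec ψ (star ψ)) m)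
          (vecMulVec ψ (star ψ))) i i)

lemma sdp_kronPow_single (m : ℕ) :
    ∃ z, kronPow (vecMulVec (Pi.single 0 1) (star (Pi.single 0 1))) m = Matrix.single z z 1 := by
  induction m with
  | zero =>
    refine ⟨0, ?_⟩
    ext i j
    have hi : i = 0 := Subsingleton.elim (α := Fin 1) _ _
    have hj : j = 0 := Subsingleton.elim (α := Fin 1) _ _
    subst hi; subst hj
    simp [kronPow]
  | succ m ih =>
    obtain ⟨z, hz⟩ := ih
    have hv : vecMulVec (Pi.single (0 : Fin 2) (1 : ℂ)) (star (Pi.single (0 : Fin 2) (1 : ℂ)))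
        = Matrix.single (0 : Fin 2) (0 : Fin 2) (1 : ℂ) := by
      ext i j; fin_cases i <;> fin_cases j <;> simp [vecMulVec_apply]
    refine ⟨finProdFinEquiv.trans (finCongr (pow_succ 2 m).symm) (z, 0), ?_⟩
    rw [kronPow, hz, hv, single_kronecker_single, reindex_apply, submatrix_single_equiv]
    simp

lemma sdp_equiv {α β : Type*} [Fintype α] [Fintype β] [DecidableEq α] [DecidableEq β]
    (hc : Fintype.card α = Fintype.card β) (s : Finset α) (t : Finset β) (h : s.card ≤ t.card) :
    ∃ e : α ≃ β, ∀ x ∈ s, e x ∈ t := by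
  obtain ⟨t', ht', hc'⟩ := Finset.exists_subset_card_eq h
  let e0 := Fintype.equivOfCardEq hc
  have hcard : s.card = (t'.map e0.symm.toEmbedding).card := by simp [hc']
  let f : {x // x ∈ s} ≃ {x // x ∈ t'.map e0.symm.toEmbedding} := Finset.equivOfCardEq hcard
  refine ⟨f.extendSubtype.trans e0, fun x hx => ht' ?_⟩
  have := f.extendSubtype_mem x hx
  rw [Finset.mem_map] at this
  obtain ⟨y, hy, hyx⟩ := this
  have : e0 (f.extendSubtype x) = y := by rw [← hyx]; simp
  simpa [this] using hy

lemma sdp_depol {D N : ℕ} (hD : 0 < D) (E : Matrix (Fin N) (Fin N) ℂ)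
    (M : Matrix (Fin D) (Fin D) ℂ) :
    ∑ x : Fin D × Fin D,
      kroneckerMap (· * ·) (1 : Matrix (Fin N) (Fin N) ℂ)
        (Matrix.single x.1 x.2 (((Real.sqrt D)⁻¹ : ℝ) : ℂ)) *
      kroneckerMap (· * ·) E M *
      (kroneckerMap (· * ·) (1 : Matrix (Fin N) (Fin N) ℂ)
        (Matrix.single x.1 x.2 (((Real.sqrt D)⁻¹ : ℝ) : ℂ)))ᴴ
      = kroneckerMap (· * ·) E ((M.trace * (D : ℂ)⁻¹) • 1) := by
  have hs : (((Real.sqrt D)⁻¹ : ℝ) : ℂ) * (((Real.sqrt D)⁻¹ : ℝ) : ℂ) = (D : ℂ)⁻¹ := by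
    rw [← Complex.ofReal_mul, ← mul_inv, Real.mul_self_sqrt (by positivity)]; simp
  have key : ∀ x : Fin D × Fin D, kroneckerMap (· * ·) (1 : Matrix (Fin N) (Fin N) ℂ)
        (Matrix.single x.1 x.2 (((Real.sqrt D)⁻¹ : ℝ) : ℂ)) *
      kroneckerMap (· * ·) E M *
      (kroneckerMap (· * ·) (1 : Matrix (Fin N) (Fin N) ℂ)
        (Matrix.single x.1 x.2 (((Real.sqrt D)⁻¹ : ℝ) : ℂ)))ᴴ
      = kroneckerMap (· * ·) E (Matrix.single x.1 x.1 (M x.2 x.2 * (D : ℂ)⁻¹)) := by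
    intro x
    rw [conjTranspose_kronecker, ← mul_kronecker_mul, ← mul_kronecker_mul,
      conjTranspose_single, single_mul_mul_single, conjTranspose_one, Matrix.one_mul,
      Matrix.mul_one]
    congr 2
    rw [← hs, Complex.star_def, Complex.conj_ofReal]; ring
  rw [Finset.sum_congr rfl fun x _ => key x]
  ext ⟨i, i'⟩ ⟨j, j'⟩
  simp only [Matrix.sum_apply, kroneckerMap_apply, ← Finset.mul_sum, Matrix.smul_apply, smul_eq_mul,
    Fintype.sum_prod_type]
  congr 1
  by_cases hij : i' = j'
  · subst hij
    simp only [single_apply, and_self, one_apply_eq, mul_one, Matrix.trace, diag_apply,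
      Finset.sum_mul]
    rw [Finset.sum_comm]
    simp
  · rw [one_apply_ne hij, mul_zero]
    refine Finset.sum_eq_zero fun a _ => Finset.sum_eq_zero fun b _ => ?_
    rw [single_apply, if_neg]
    rintro ⟨rfl, rfl⟩; exact hij rfl

lemma sdp_depol_tp {D N : ℕ} (hD : 0 < D) :
    ∑ x : Fin D × Fin D,
      (kroneckerMap (· * ·) (1 : Matrix (Fin N) (Fin N) ℂ)
        (Matrix.single x.1 x.2 (((Real.sqrt D)⁻¹ : ℝ) : ℂ)))ᴴ *
      kroneckerMap (· * ·) (1 : Matrix (Fin N) (Fin N) ℂ)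
        (Matrix.single x.1 x.2 (((Real.sqrt D)⁻¹ : ℝ) : ℂ)) = 1 := by
  have h := sdp_depol hD (1 : Matrix (Fin N) (Fin N) ℂ) 1
  have hD' : (D : ℂ) ≠ 0 := by exact_mod_cast hD.ne'
  rw [trace_one, Fintype.card_fin, mul_inv_cancel₀ hD', one_smul, one_kronecker_one] at h
  rw [← h, ← (Equiv.prodComm (Fin D) (Fin D)).sum_comp]
  refine Finset.sum_congr rfl fun x _ => ?_
  rw [Matrix.mul_one]
  simp only [conjTranspose_kronecker, conjTranspose_single, Complex.star_def, Complex.conj_ofReal,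
    Equiv.prodComm_apply, Prod.fst_swap, Prod.snd_swap, conjTranspose_one]

lemma sdp_exists {d n : ℕ} (hd : 0 < d) {ρ : Matrix (Fin d) (Fin d) ℂ}
    (U : Matrix (Fin d) (Fin d) ℂ) (p : Fin d → ℝ) (hU1 : U * Uᴴ = 1) (hU2 : Uᴴ * U = 1)
    (hρ : ρ = U * diagonal (fun i => (p i : ℂ)) * Uᴴ)
    (hc : (Finset.univ.filter (fun i => p i ≠ 0)).card * n ≤ d)
    (htr : 1 = ∑ i, (p i : ℂ)) (z : Fin n) :
    ∃ Λ : Matrix (Fin d × Fin n) (Fin d × Fin n) ℂ → Matrix (Fin n × Fin d) (Fin n × Fin d) ℂ,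
      IsChannel Λ ∧ Λ 1 = 1 ∧
      Λ (kroneckerMap (· * ·) ρ (((n : ℕ) : ℂ)⁻¹ • (1 : Matrix (Fin n) (Fin n) ℂ))) =
        kroneckerMap (· * ·) (Matrix.single z z 1)
          ((d : ℂ)⁻¹ • (1 : Matrix (Fin d) (Fin d) ℂ)) := by
  have hn : (n : ℂ) ≠ 0 := by
    have := z.pos
    exact_mod_cast this.ne'
  have hdC : (d : ℂ) ≠ 0 := by exact_mod_cast hd.ne'
  obtain ⟨e, he⟩ := sdp_equiv (α := Fin d × Fin n) (β := Fin n × Fin d)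
    (by simp [mul_comm])
    ((Finset.univ.filter (fun i => p i ≠ 0)) ×ˢ Finset.univ) ({z} ×ˢ Finset.univ)
    (by simpa using hc)
  let W : Matrix (Fin d × Fin n) (Fin d × Fin n) ℂ :=
    kroneckerMap (· * ·) Uᴴ (1 : Matrix (Fin n) (Fin n) ℂ)
  let V : Matrix (Fin n × Fin d) (Fin d × Fin n) ℂ := W.submatrix e.symm (Equiv.refl _)
  have hVh : Vᴴ = Wᴴ.submatrix (Equiv.refl _) e.symm := rfl
  have hW1 : W * Wᴴ = 1 := by
    simp only [W]
    rw [conjTranspose_kronecker, ← mul_kronecker_mul]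
    simp [hU2]
  have hW2 : Wᴴ * W = 1 := by
    simp only [W]
    rw [conjTranspose_kronecker, ← mul_kronecker_mul]
    simp [hU1]
  have hV1 : V * Vᴴ = 1 := by
    rw [hVh]; simp only [V]
    rw [submatrix_mul_equiv, hW1]; simp
  have hV2 : Vᴴ * V = 1 := by
    rw [hVh]; simp only [V]
    rw [submatrix_mul_equiv, hW2]; simp
  let q : Fin n × Fin d → ℂ := fun x => (p (e.symm x).1 : ℂ) * (n : ℂ)⁻¹
  have hq0 : ∀ x, x.1 ≠ z → q x = 0 := by
    intro x hx
    by_contra h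
    have h1 : p (e.symm x).1 ≠ 0 := by
      intro h2; apply h; simp [q, h2]
    have := he (e.symm x) (by simpa using h1)
    rw [Equiv.apply_symm_apply, Finset.mem_product, Finset.mem_singleton] at this
    exact hx this.1
  have hqs : ∑ b, q (z, b) = 1 := by
    have h1 : ∑ x, q x = ∑ b, q (z, b) := by
      rw [Fintype.sum_prod_type]
      refine Finset.sum_eq_single z (fun a _ ha => ?_) (by simp)
      exact Finset.sum_eq_zero fun b _ => hq0 _ ha
    have h2 : ∑ x, q x = ∑ y : Fin d × Fin n, (p y.1 : ℂ) * (n : ℂ)⁻¹ :=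
      e.symm.sum_comp (fun y : Fin d × Fin n => (p y.1 : ℂ) * (n : ℂ)⁻¹)
    rw [← h1, h2, Fintype.sum_prod_type]
    simp only [Finset.sum_const, Finset.card_univ, Fintype.card_fin, nsmul_eq_mul]
    rw [← Finset.mul_sum, ← Finset.sum_mul, ← htr]
    field_simp
  have hVA : V * kroneckerMap (· * ·) ρ ((n : ℂ)⁻¹ • (1 : Matrix (Fin n) (Fin n) ℂ)) * Vᴴ
      = kroneckerMap (· * ·) (Matrix.single z z (1 : ℂ)) (diagonal fun b => q (z, b)) := by
    have h1 : W * kroneckerMap (· * ·) ρ ((n : ℂ)⁻¹ • (1 : Matrix (Fin n) (Fin n) ℂ)) * Wᴴ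
        = diagonal (fun y : Fin d × Fin n => (p y.1 : ℂ) * (n : ℂ)⁻¹) := by
      simp only [W]
      have h3 : Uᴴ * ρ * U = diagonal (fun i => (p i : ℂ)) := by
        rw [hρ]
        calc Uᴴ * (U * diagonal (fun i => (p i : ℂ)) * Uᴴ) * U
            = (Uᴴ * U) * diagonal (fun i => (p i : ℂ)) * (Uᴴ * U) := by
              simp only [Matrix.mul_assoc]
          _ = _ := by rw [hU2]; simp
      rw [conjTranspose_kronecker, ← mul_kronecker_mul, ← mul_kronecker_mul,
        conjTranspose_conjTranspose, h3, conjTranspose_one, Matrix.one_mul, Matrix.mul_one,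
        smul_one_eq_diagonal, diagonal_kronecker_diagonal]
    have h2 : V * kroneckerMap (· * ·) ρ ((n : ℂ)⁻¹ • (1 : Matrix (Fin n) (Fin n) ℂ)) * Vᴴ
        = (W * kroneckerMap (· * ·) ρ ((n : ℂ)⁻¹ • (1 : Matrix (Fin n) (Fin n) ℂ)) * Wᴴ).submatrix
          e.symm e.symm := rfl
    rw [h2, h1]
    ext ⟨i, i'⟩ ⟨j, j'⟩
    simp only [submatrix_apply, diagonal_apply, kroneckerMap_apply, single_apply,
      EmbeddingLike.apply_eq_iff_eq, Prod.mk.injEq]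
    have := hq0 (i, i')
    simp only [q] at this ⊢
    by_cases hi : z = i
    · subst hi
      by_cases hj : z = j
      · subst hj; simp
      · simp [hj]
    · simp [hi, this (fun h => hi h.symm)]
  let D : Fin d × Fin d → Matrix (Fin n × Fin d) (Fin n × Fin d) ℂ := fun x =>
    kroneckerMap (· * ·) (1 : Matrix (Fin n) (Fin n) ℂ)
        (Matrix.single x.1 x.2 (((Real.sqrt d)⁻¹ : ℝ) : ℂ))
  have hsum : ∀ R : Matrix (Fin d × Fin n) (Fin d × Fin n) ℂ,
      ∑ i : Fin (d * d), (D (finProdFinEquiv.symm i) * V) * R * (D (finProdFinEquiv.symm i) * V)ᴴ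
      = ∑ x, D x * (V * R * Vᴴ) * (D x)ᴴ := by
    intro R
    rw [← finProdFinEquiv.symm.sum_comp (fun x => D x * (V * R * Vᴴ) * (D x)ᴴ)]
    refine Finset.sum_congr rfl fun i _ => ?_
    simp only [conjTranspose_mul, Matrix.mul_assoc]
  refine ⟨fun R => ∑ i : Fin (d * d),
    (D (finProdFinEquiv.symm i) * V) * R * (D (finProdFinEquiv.symm i) * V)ᴴ,
    ⟨d * d, fun i => D (finProdFinEquiv.symm i) * V, ?_, fun R => rfl⟩, ?_, ?_⟩
  · have h1 : ∑ i : Fin (d * d), (D (finProdFinEquiv.symm i) * V)ᴴ *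
        (D (finProdFinEquiv.symm i) * V) = Vᴴ * (∑ x, (D x)ᴴ * D x) * V := by
      rw [Matrix.mul_sum, Matrix.sum_mul,
        ← finProdFinEquiv.symm.sum_comp (fun x => Vᴴ * ((D x)ᴴ * D x) * V)]
      refine Finset.sum_congr rfl fun i _ => ?_
      simp only [conjTranspose_mul, Matrix.mul_assoc]
    rw [h1, sdp_depol_tp hd, Matrix.mul_one, hV2]
  · have h := sdp_depol hd (1 : Matrix (Fin n) (Fin n) ℂ) 1
    rw [trace_one, Fintype.card_fin, mul_inv_cancel₀ hdC, one_smul, one_kronecker_one] at h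
    beta_reduce
    rw [hsum, Matrix.mul_one, hV1, h]
  · beta_reduce
    rw [hsum, hVA, sdp_depol hd, trace_diagonal, hqs, one_mul]

lemma sdp_bound {d d₁ d₂ N k : ℕ} {ρ : Matrix (Fin d) (Fin d) ℂ}
    (U : Matrix (Fin d) (Fin d) ℂ) (p : Fin d → ℝ) (hU1 : U * Uᴴ = 1) (hU2 : Uᴴ * U = 1)
    (hρ : ρ = U * diagonal (fun i => (p i : ℂ)) * Uᴴ) (hp : ∀ i, 0 ≤ p i)
    (hd2 : 0 < d₂)
    (K : Fin k → Matrix (Fin N × Fin d₁) (Fin d × Fin d₂) ℂ)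
    (h1 : (∑ i, (K i)ᴴ * K i) = 1) (h2 : (∑ i, K i * (K i)ᴴ) = 1)
    (Ψ : Matrix (Fin N) (Fin N) ℂ) (q1 : Ψᴴ = Ψ) (q2 : Ψ * Ψ = Ψ) (q3 : Ψ.trace = 1)
    (hB : ∑ i, K i * (kroneckerMap (· * ·) ρ
        ((d₂ : ℂ)⁻¹ • (1 : Matrix (Fin d₂) (Fin d₂) ℂ))) * (K i)ᴴ =
      kroneckerMap (· * ·) Ψ ((d₁ : ℂ)⁻¹ • (1 : Matrix (Fin d₁) (Fin d₁) ℂ))) :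
    (Finset.univ.filter (fun i => p i ≠ 0)).card * d₂ ≤ d₁ := by
  have hd2C : (d₂ : ℂ) ≠ 0 := by exact_mod_cast hd2.ne'
  let one2 : Matrix (Fin d₂) (Fin d₂) ℂ := 1
  let c : ℂ := (((Real.sqrt d₂)⁻¹ : ℝ) : ℂ)
  have hcc : c * c = (d₂ : ℂ)⁻¹ := by
    simp only [c]
    rw [← Complex.ofReal_mul, ← mul_inv, Real.mul_self_sqrt (by positivity)]; simp
  have hcs : star c = c := by simp [c]
  let F : (Fin d → ℂ) → Matrix (Fin d) (Fin d) ℂ := fun f => U * diagonal f * Uᴴ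
  have hF : ∀ f g, F f * F g = F (fun i => f i * g i) := by
    intro f g
    simp only [F]
    calc U * diagonal f * Uᴴ * (U * diagonal g * Uᴴ)
        = U * diagonal f * (Uᴴ * U) * diagonal g * Uᴴ := by simp only [Matrix.mul_assoc]
      _ = _ := by rw [hU2, Matrix.mul_one, Matrix.mul_assoc U, diagonal_mul_diagonal]
  have hFh : ∀ f, (F f)ᴴ = F (star f) := by
    intro f
    simp only [F, conjTranspose_mul, conjTranspose_conjTranspose, diagonal_conjTranspose,
      Matrix.mul_assoc]
  have hFt : ∀ f, (F f).trace = ∑ i, f i := by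
    intro f
    simp only [F]
    rw [Matrix.trace_mul_comm, ← Matrix.mul_assoc, hU2, Matrix.one_mul, trace_diagonal]
  let s : Fin d → ℂ := fun i => if p i ≠ 0 then 1 else 0
  let C := kroneckerMap (· * ·) (F fun i => (Real.sqrt (p i) : ℂ)) (c • one2)
  let G := kroneckerMap (· * ·) (F fun i => (p i : ℂ)⁻¹) ((d₂ : ℂ) • one2)
  let S := kroneckerMap (· * ·) (F s) one2
  have hs : star s = s := by
    funext i; simp only [s, Pi.star_apply]; split_ifs <;> simp
  have hCC : C * Cᴴ = kroneckerMap (· * ·) ρ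
        ((d₂ : ℂ)⁻¹ • (1 : Matrix (Fin d₂) (Fin d₂) ℂ)) := by
    simp only [C, one2]
    rw [conjTranspose_kronecker, ← mul_kronecker_mul, hFh, hF]
    congr 1
    · rw [hρ]
      simp only [F]
      congr 3
      funext i
      simp only [Pi.star_apply, Complex.star_def, Complex.conj_ofReal]
      rw [← Complex.ofReal_mul, Real.mul_self_sqrt (hp i)]
    · rw [conjTranspose_smul, conjTranspose_one, hcs, smul_mul_smul_comm, hcc, Matrix.mul_one]
  have hle := sdp_upper K h1 h2 C G S (kroneckerMap (· * ·) Ψ (1 : Matrix (Fin d₁) (Fin d₁) ℂ))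
    (by rw [conjTranspose_kronecker, q1, conjTranspose_one])
    (by rw [← mul_kronecker_mul, q2, Matrix.one_mul]) (d₁ : ℂ)⁻¹
    (by rw [hCC, hB]; exact kronecker_smul _ _ _)
    (by
      rw [hCC]
      simp only [S, G, one2]
      rw [← mul_kronecker_mul, smul_mul_smul_comm, inv_mul_cancel₀ hd2C, Matrix.one_mul, one_smul]
      congr 1
      have : ρ = F fun i => (p i : ℂ) := hρ
      rw [this, hF]
      congr 1
      funext i
      simp only [s]
      split_ifs with h
      · rw [mul_inv_cancel₀]; exact_mod_cast h
      · simp only [ne_eq, not_not] at h; simp [h])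
    (by simp only [S, one2]; rw [conjTranspose_kronecker, hFh, hs, conjTranspose_one])
    (by
      simp only [S, one2]
      rw [← mul_kronecker_mul, hF, Matrix.one_mul]
      congr 2
      funext i; simp [s])
  have e1 : S.trace = ((Finset.univ.filter (fun i => p i ≠ 0)).card * d₂ : ℕ) := by
    simp only [S, one2]
    rw [trace_kronecker, hFt, trace_one]
    simp [s, Finset.sum_ite]
  have e2 : (kroneckerMap (· * ·) Ψ (1 : Matrix (Fin d₁) (Fin d₁) ℂ)).trace = (d₁ : ℕ) := by
    rw [trace_kronecker, q3, trace_one]; simp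
  rw [e1, e2, Complex.natCast_re, Complex.natCast_re] at hle
  exact_mod_cast hle

/-- the single-shot distillable purity of a state `ρ` of rank `r` in
dimension `d` (with `d ≥ 2r`) equals `⌊log₂(d/r)⌋`: the largest `m` such that
`ρ ⊗ I/d₂` can be mapped to `ψ₂^{⊗m} ⊗ I/d₁` by a unital channel (with
`d·d₂ = 2^m·d₁`) is `m = ⌊log₂(d/r)⌋`. -/
theorem single_shot_distillable_purity (d r : ℕ) (hd : 0 < d) (hr : 0 < r)
    (hdr : 2 * r ≤ d)
    (ρ : Matrix (Fin d) (Fin d) ℂ) (hρ : IsDensity ρ) (hrank : ρ.rank = r) :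
    IsGreatest {m : ℕ |
      ∃ d₁ d₂ : ℕ, 0 < d₁ ∧ 0 < d₂ ∧ d * d₂ = 2 ^ m * d₁ ∧
        ∃ ψ : Fin 2 → ℂ, star ψ ⬝ᵥ ψ = 1 ∧
          ∃ Λ : Matrix (Fin d × Fin d₂) (Fin d × Fin d₂) ℂ →
              Matrix (Fin (2 ^ m) × Fin d₁) (Fin (2 ^ m) × Fin d₁) ℂ,
            IsChannel Λ ∧ Λ 1 = 1 ∧
            Λ (Matrix.kroneckerMap (· * ·) ρ
                ((d₂ : ℂ)⁻¹ • (1 : Matrix (Fin d₂) (Fin d₂) ℂ))) =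
              Matrix.kroneckerMap (· * ·) (kronPow (vecMulVec ψ (star ψ)) m)
                ((d₁ : ℂ)⁻¹ • (1 : Matrix (Fin d₁) (Fin d₁) ℂ))}
      (Nat.log 2 (d / r)) := by
  have hd' := hd
  obtain ⟨U, p, hU1, hU2, hUρ, hcard, hp, htr⟩ := sdp_spectral ρ hρ.1
  rw [hrank] at hcard
  rw [hρ.2] at htr
  constructor
  · set m := Nat.log 2 (d / r) with hm
    have hmr : 2 ^ m * r ≤ d := by
      have h1 : d / r ≠ 0 := by
        have : 0 < d / r := Nat.div_pos (by omega) hr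
        omega
      have h2 : 2 ^ m ≤ d / r := Nat.pow_log_le_self 2 h1
      exact (Nat.le_div_iff_mul_le hr).1 h2
    refine ⟨d, 2 ^ m, hd, by positivity, by ring, Pi.single 0 1, by simp, ?_⟩
    obtain ⟨z, hz⟩ := sdp_kronPow_single m
    rw [hz]
    exact sdp_exists hd U p hU1 hU2 hUρ (by rw [hcard, mul_comm]; exact hmr) htr z
  · rintro m ⟨d₁, d₂, hd1, hd2, hdd, ψ, hψ, Λ, ⟨k, K, hK1, hK⟩, hΛ1, hΛ⟩
    obtain ⟨q1, q2, q3⟩ := sdp_kronPow ψ hψ m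
    set Ψ := kronPow (vecMulVec ψ (star ψ)) m
    have hle := sdp_bound U p hU1 hU2 hUρ hp hd2 K hK1
      (by rw [hK] at hΛ1; simpa using hΛ1) Ψ q1 q2 q3 (by rw [hK] at hΛ; exact hΛ)
    rw [hcard] at hle
    have h3 : 2 ^ m * r * d₂ ≤ d * d₂ := by
      rw [hdd, mul_assoc]; exact Nat.mul_le_mul_left _ hle
    have h4 := Nat.le_of_mul_le_mul_right h3 hd2
    have h5 : 2 ^ m ≤ d / r := (Nat.le_div_iff_mul_le hr).2 h4
    exact Nat.le_log_of_pow_le (by norm_num) h5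
end
end

section
/- The single-shot purity cost of a state ρ with maximal eigenvalue λ_max in dimension d equals ⌈log₂(d·λ_max)⌉: the smallest integer m for which there exist dimensions d₁, d₂ with 2^m·d₁ = d·d₂ and a unital channel Λ with Λ(ψ₂^{⊗m} ⊗ I/d₁) = ρ ⊗ I/d₂ is m = ⌈log₂(d·λ_max)⌉. -/
open Matrix BigOperators
open scoped ComplexOrder

noncomputable section

theorem PurityCost.isChannel_of_kraus {m n ι : Type*} [Fintype m] [Fintype n] [DecidableEq m]
    [Fintype ι] (K : ι → Matrix n m ℂ) (hK : (∑ i, (K i)ᴴ * K i) = 1) :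
    IsChannel (fun X : Matrix m m ℂ => ∑ i, K i * X * (K i)ᴴ) := by
  refine ⟨Fintype.card ι, fun i => K ((Fintype.equivFin ι).symm i), ?_, fun X => ?_⟩
  · rw [← hK]
    exact (Fintype.equivFin ι).symm.sum_comp (fun i => (K i)ᴴ * K i)
  · exact ((Fintype.equivFin ι).symm.sum_comp (fun i => K i * X * (K i)ᴴ)).symm

/-- `∑ E_{ab} X E_{ab}ᴴ = tr X • 1`. -/
theorem PurityCost.sum_single {m n : Type*} [Fintype m] [Fintype n] [DecidableEq m] [DecidableEq n]
    (X : Matrix m m ℂ) :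
    ∑ p : n × m, (single p.1 p.2 (1 : ℂ)) * X * (single p.1 p.2 (1 : ℂ))ᴴ = X.trace • 1 := by
  simp only [conjTranspose_single, single_mul_mul_single, star_one, one_mul, mul_one,
    Fintype.sum_prod_type]
  ext i j
  simp only [Matrix.sum_apply, single_apply, Matrix.smul_apply, one_apply, trace, diag, smul_eq_mul]
  rw [Finset.sum_comm]
  simp only [Finset.sum_mul]
  refine Finset.sum_congr rfl fun b _ => ?_
  by_cases h : i = j
  · subst h; simp
  · simp only [h, if_false, mul_zero]
    refine Finset.sum_eq_zero fun a _ => if_neg ?_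
    rintro ⟨rfl, h2⟩
    exact h h2

theorem PurityCost.sum_single' {m n : Type*} [Fintype m] [Fintype n] [DecidableEq m] [DecidableEq n]
    (X : Matrix n n ℂ) :
    ∑ p : n × m, (single p.1 p.2 (1 : ℂ))ᴴ * X * (single p.1 p.2 (1 : ℂ)) = X.trace • 1 := by
  rw [← PurityCost.sum_single (n := m) X, ← (Equiv.prodComm n m).sum_comp]
  simp

theorem PurityCost.exists_sqrt {n : Type*} [Fintype n] [DecidableEq n] {A : Matrix n n ℂ}
    (hA : A.PosSemidef) : ∃ S : Matrix n n ℂ, A = S * Sᴴ := by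
  open scoped MatrixOrder in
  obtain ⟨B, hB⟩ := CStarAlgebra.nonneg_iff_eq_star_mul_self.mp hA.nonneg
  exact ⟨Bᴴ, by simpa [star_eq_conjTranspose] using hB⟩

theorem PurityCost.measure_prepare {m n : Type*} [Fintype m] [Fintype n] [DecidableEq m]
    [DecidableEq n] (P Q : Matrix m m ℂ) (hP : Pᴴ = P) (hPP : P * P = P)
    (hQ : Qᴴ = Q) (hQQ : Q * Q = Q)
    {A B : Matrix n n ℂ} (hA : A.PosSemidef) (hB : B.PosSemidef)
    (h : A.trace • P + B.trace • Q = 1) :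
    IsChannel (fun X : Matrix m m ℂ => (P * X).trace • A + (Q * X).trace • B) := by
  obtain ⟨S, hS⟩ := PurityCost.exists_sqrt hA
  obtain ⟨T, hT⟩ := PurityCost.exists_sqrt hB
  have key := PurityCost.isChannel_of_kraus (m := m) (n := n) (ι := (n × m) ⊕ (n × m))
    (Sum.elim (fun p => S * single p.1 p.2 (1 : ℂ) * P) (fun p => T * single p.1 p.2 (1 : ℂ) * Q)) ?_
  · convert key using 2 with X
    rw [Fintype.sum_sum_type]
    have aux : ∀ (S : Matrix n n ℂ) (P : Matrix m m ℂ), Pᴴ = P → P * P = P →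
        ∑ p : n × m, (S * single p.1 p.2 (1 : ℂ) * P) * X * (S * single p.1 p.2 (1 : ℂ) * P)ᴴ
          = (P * X).trace • (S * Sᴴ) := by
      intro S P hP hPP
      have h1 : ∀ p : n × m,
          (S * single p.1 p.2 (1 : ℂ) * P) * X * (S * single p.1 p.2 (1 : ℂ) * P)ᴴ
          = S * (single p.1 p.2 (1 : ℂ) * (P * X * P) * (single p.1 p.2 (1 : ℂ))ᴴ) * Sᴴ := by
        intro p
        simp only [conjTranspose_mul, hP, Matrix.mul_assoc]
      simp only [h1]
      rw [← Matrix.sum_mul, ← Matrix.mul_sum, PurityCost.sum_single, trace_mul_comm,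
        ← Matrix.mul_assoc, hPP]
      simp
    simp only [Sum.elim_inl, Sum.elim_inr]
    rw [aux S P hP hPP, aux T Q hQ hQQ, hS, hT]
  · rw [Fintype.sum_sum_type]
    have aux : ∀ (S : Matrix n n ℂ) (P : Matrix m m ℂ), Pᴴ = P → P * P = P →
        ∑ p : n × m, (S * single p.1 p.2 (1 : ℂ) * P)ᴴ * (S * single p.1 p.2 (1 : ℂ) * P)
          = (S * Sᴴ).trace • P := by
      intro S P hP hPP
      have h1 : ∀ p : n × m,
          (S * single p.1 p.2 (1 : ℂ) * P)ᴴ * (S * single p.1 p.2 (1 : ℂ) * P)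
          = P * ((single p.1 p.2 (1 : ℂ))ᴴ * (Sᴴ * S) * single p.1 p.2 (1 : ℂ)) * P := by
        intro p
        simp only [conjTranspose_mul, hP, Matrix.mul_assoc]
      simp only [h1]
      rw [← Matrix.sum_mul, ← Matrix.mul_sum, PurityCost.sum_single', trace_mul_comm]
      simp [hPP]
    simp only [Sum.elim_inl, Sum.elim_inr]
    rw [aux S P hP hPP, aux T Q hQ hQQ, ← hS, ← hT, h]

theorem PurityCost.channel_psd {m n : Type*} [Fintype m] [Fintype n] [DecidableEq m]
    {Λ : Matrix m m ℂ → Matrix n n ℂ} (h : IsChannel Λ) {X : Matrix m m ℂ}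
    (hX : X.PosSemidef) : (Λ X).PosSemidef := by
  obtain ⟨k, K, -, hK⟩ := h
  rw [hK]
  exact posSemidef_sum _ fun i _ => hX.mul_mul_conjTranspose_same (K i)

theorem PurityCost.channel_smul_sub {m n : Type*} [Fintype m] [Fintype n] [DecidableEq m]
    {Λ : Matrix m m ℂ → Matrix n n ℂ} (h : IsChannel Λ) (c : ℂ) (X Y : Matrix m m ℂ) :
    Λ (c • X - Y) = c • Λ X - Λ Y := by
  obtain ⟨k, K, -, hK⟩ := h
  simp [hK, Matrix.mul_sub, Matrix.sub_mul, Finset.smul_sum]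

theorem PurityCost.psd_iff {n : Type*} [Fintype n] [DecidableEq n] {A : Matrix n n ℂ}
    (hA : A.IsHermitian) (t : ℝ) :
    ((t : ℂ) • (1 : Matrix n n ℂ) - A).PosSemidef ↔ ∀ i, hA.eigenvalues i ≤ t := by
  have h : (t : ℂ) • (1 : Matrix n n ℂ) - A =
      (hA.eigenvectorUnitary : Matrix n n ℂ) *
        diagonal (fun i => ((t - hA.eigenvalues i : ℝ) : ℂ)) *
        star (hA.eigenvectorUnitary : Matrix n n ℂ) := by
    have h1 : diagonal (fun i => ((t - hA.eigenvalues i : ℝ) : ℂ)) =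
        (t : ℂ) • (1 : Matrix n n ℂ) - diagonal (RCLike.ofReal ∘ hA.eigenvalues) := by
      ext i j
      by_cases hij : i = j
      · subst hij; simp
      · simp [hij]
    rw [h1]
    conv_lhs => rw [hA.spectral_theorem]
    simp [Matrix.mul_sub, Matrix.sub_mul, Unitary.conjStarAlgAut_apply]
  rw [h, Unitary.isUnit_coe.posSemidef_star_right_conjugate_iff, posSemidef_diagonal_iff]
  simp only [Complex.zero_le_real, sub_nonneg]

theorem PurityCost.kronPow_props (ψ : Matrix (Fin 2) (Fin 2) ℂ) (h1 : ψᴴ = ψ) (h2 : ψ * ψ = ψ)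
    (h3 : ψ.trace = 1) (m : ℕ) :
    (kronPow ψ m)ᴴ = kronPow ψ m ∧ kronPow ψ m * kronPow ψ m = kronPow ψ m ∧
      (kronPow ψ m).trace = 1 := by
  induction m with
  | zero => simp [kronPow]
  | succ m ih =>
    obtain ⟨a, b, c⟩ := ih
    refine ⟨?_, ?_, ?_⟩
    · simp only [kronPow, reindex_apply, conjTranspose_submatrix]
      congr 1
      exact (conjTranspose_kronecker _ _).trans (by rw [a, h1])
    · simp only [kronPow, reindex_apply, submatrix_mul_equiv]
      congr 1
      exact (mul_kronecker_mul _ _ _ _).symm.trans (by rw [b, h2])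
    · simp only [kronPow, reindex_apply]
      refine Eq.trans ?_ ((trace_kronecker (kronPow ψ m) ψ).trans (by rw [c, h3, one_mul]))
      simp only [trace, diag, submatrix_apply]
      exact Equiv.sum_comp (finProdFinEquiv.trans (finCongr (pow_succ 2 m).symm)).symm
        (fun i => kroneckerMap (· * ·) (kronPow ψ m) ψ i i)

theorem PurityCost.pure_props (ψ : Fin 2 → ℂ) (h : star ψ ⬝ᵥ ψ = 1) :
    (vecMulVec ψ (star ψ))ᴴ = vecMulVec ψ (star ψ) ∧
    vecMulVec ψ (star ψ) * vecMulVec ψ (star ψ) = vecMulVec ψ (star ψ) ∧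
    (vecMulVec ψ (star ψ)).trace = 1 := by
  refine ⟨by simp [conjTranspose_vecMulVec], ?_, ?_⟩
  · rw [vecMulVec_mul_vecMulVec, h]; simp
  · rw [trace_vecMulVec, dotProduct_comm, h]

theorem PurityCost.unital_exists {m n : Type*} [Fintype m] [Fintype n] [DecidableEq m]
    [DecidableEq n] (hmn : Fintype.card m = Fintype.card n)
    (P : Matrix m m ℂ) (hP : Pᴴ = P) (hPP : P * P = P) (r : ℂ) (hr : P.trace = r) (hr0 : r ≠ 0)
    {A : Matrix n n ℂ} (hA : A.PosSemidef) (hA1 : A.trace = 1) (hle : (1 - r • A).PosSemidef) :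
    ∃ Λ : Matrix m m ℂ → Matrix n n ℂ, IsChannel Λ ∧ Λ 1 = 1 ∧ Λ (r⁻¹ • P) = A := by
  have hQ : (1 - P)ᴴ = 1 - P := by simp [hP]
  have hQQ : (1 - P) * (1 - P) = 1 - P := by simp [Matrix.mul_sub, Matrix.sub_mul, hPP]
  have hQP : (1 - P) * P = 0 := by simp [Matrix.sub_mul, hPP]
  have hQpsd : (1 - P).PosSemidef := by
    have := posSemidef_conjTranspose_mul_self (1 - P)
    rwa [hQ, hQQ] at this
  have htr : (1 - r • A).trace = (1 - P).trace := by
    simp [trace_sub, hr, hA1, hmn]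
  have ht0 : 0 ≤ (1 - P).trace := hQpsd.trace_nonneg
  have hq : (1 - P).trace = 0 → 1 - P = 0 := fun h => hQpsd.trace_eq_zero_iff.mp h
  have hb : (1 - P).trace = 0 → 1 - r • A = 0 := fun h =>
    hle.trace_eq_zero_iff.mp (htr.trans h)
  set Q := 1 - P with hQdef
  refine ⟨_, PurityCost.measure_prepare P Q hP hPP hQ hQQ hA
    (hle.smul (inv_nonneg.mpr ht0)) ?_, ?_, ?_⟩
  · rw [hA1, trace_smul, htr]
    by_cases h : Q.trace = 0
    · rw [hq h]; rw [hq h] at hQdef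
      simpa using (sub_eq_zero.mp hQdef.symm).symm
    · rw [smul_eq_mul, inv_mul_cancel₀ h, one_smul, one_smul, hQdef]; simp
  · simp only [Matrix.mul_one, hr]
    by_cases h : Q.trace = 0
    · rw [h, zero_smul, add_zero]
      exact (sub_eq_zero.mp (hb h)).symm
    · rw [smul_smul, mul_inv_cancel₀ h, one_smul]; simp
  · simp [hPP, hQP, hr, hr0]

theorem PurityCost.toNat_ceil_le {x : ℝ} (hx : 0 < x) (m : ℕ) :
    ⌈Real.logb 2 x⌉.toNat ≤ m ↔ x ≤ 2 ^ m := by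
  rw [Int.toNat_le, Int.ceil_le, Real.logb_le_iff_le_rpow (by norm_num) hx]
  simp

/-- the single-shot purity cost of a state `ρ` with maximal eigenvalue
`λ_max` in dimension `d` equals `⌈log₂(d·λ_max)⌉`: the smallest `m` such that
`ψ₂^{⊗m} ⊗ I/d₁` can be mapped to `ρ ⊗ I/d₂` by a unital channel (with
`2^m·d₁ = d·d₂`) is `m = ⌈log₂(d·λ_max)⌉`. -/
theorem single_shot_purity_cost (d : ℕ) (hd : 0 < d)
    (ρ : Matrix (Fin d) (Fin d) ℂ) (hρ : IsDensity ρ)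
    (lmax : ℝ) (hlmax : IsGreatest (Set.range hρ.1.1.eigenvalues) lmax) :
    IsLeast {m : ℕ |
      ∃ d₁ d₂ : ℕ, 0 < d₁ ∧ 0 < d₂ ∧ 2 ^ m * d₁ = d * d₂ ∧
        ∃ ψ : Fin 2 → ℂ, star ψ ⬝ᵥ ψ = 1 ∧
          ∃ Λ : Matrix (Fin (2 ^ m) × Fin d₁) (Fin (2 ^ m) × Fin d₁) ℂ →
              Matrix (Fin d × Fin d₂) (Fin d × Fin d₂) ℂ,
            IsChannel Λ ∧ Λ 1 = 1 ∧
            Λ (Matrix.kroneckerMap (· * ·) (kronPow (vecMulVec ψ (star ψ)) m)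
                ((d₁ : ℂ)⁻¹ • (1 : Matrix (Fin d₁) (Fin d₁) ℂ))) =
              Matrix.kroneckerMap (· * ·) ρ
                ((d₂ : ℂ)⁻¹ • (1 : Matrix (Fin d₂) (Fin d₂) ℂ))}
      (⌈Real.logb 2 (d * lmax)⌉.toNat) := by
  have htrace : (1 : ℝ) ≤ d * lmax := by
    have h1 := hρ.2.symm.trans hρ.1.1.trace_eq_sum_eigenvalues
    have h2 : (1 : ℝ) = ∑ i, hρ.1.1.eigenvalues i := by
      have := congrArg Complex.re h1
      simpa using this
    rw [h2]
    calc ∑ i, hρ.1.1.eigenvalues i ≤ ∑ _i : Fin d, lmax :=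
          Finset.sum_le_sum fun i _ => hlmax.2 ⟨i, rfl⟩
      _ = d * lmax := by simp
  have hpos : 0 < d * lmax := by linarith
  have hdR : (0 : ℝ) < d := by exact_mod_cast hd
  have hproj : ∀ (m d₁ : ℕ) (ψ : Fin 2 → ℂ), star ψ ⬝ᵥ ψ = 1 →
      (Matrix.kroneckerMap (· * ·) (kronPow (vecMulVec ψ (star ψ)) m)
        (1 : Matrix (Fin d₁) (Fin d₁) ℂ))ᴴ =
      Matrix.kroneckerMap (· * ·) (kronPow (vecMulVec ψ (star ψ)) m)
        (1 : Matrix (Fin d₁) (Fin d₁) ℂ) ∧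
      Matrix.kroneckerMap (· * ·) (kronPow (vecMulVec ψ (star ψ)) m)
        (1 : Matrix (Fin d₁) (Fin d₁) ℂ) *
      Matrix.kroneckerMap (· * ·) (kronPow (vecMulVec ψ (star ψ)) m)
        (1 : Matrix (Fin d₁) (Fin d₁) ℂ) =
      Matrix.kroneckerMap (· * ·) (kronPow (vecMulVec ψ (star ψ)) m)
        (1 : Matrix (Fin d₁) (Fin d₁) ℂ) ∧
      (Matrix.kroneckerMap (· * ·) (kronPow (vecMulVec ψ (star ψ)) m)
        (1 : Matrix (Fin d₁) (Fin d₁) ℂ)).trace = d₁ := by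
    intro m d₁ ψ hψ
    obtain ⟨a, b, c⟩ := PurityCost.pure_props ψ hψ
    obtain ⟨a, b, c⟩ := PurityCost.kronPow_props _ a b c m
    refine ⟨(conjTranspose_kronecker _ _).trans (by rw [a, conjTranspose_one]),
      (mul_kronecker_mul _ _ _ _).symm.trans (by rw [b, Matrix.one_mul]),
      (trace_kronecker _ _).trans (by rw [c]; simp)⟩
  constructor
  · set m := ⌈Real.logb 2 (d * lmax)⌉.toNat with hm
    have hle : (d : ℝ) * lmax ≤ 2 ^ m := (PurityCost.toNat_ceil_le hpos m).mp le_rfl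
    refine ⟨d, 2 ^ m, hd, by positivity, by ring, Pi.single 0 1, by simp, ?_⟩
    obtain ⟨a, b, c⟩ := hproj m d (Pi.single 0 1) (by simp)
    have hdC : (d : ℂ) ≠ 0 := by exact_mod_cast hd.ne'
    have h2 : (1 : Matrix (Fin (2 ^ m)) (Fin (2 ^ m)) ℂ).PosSemidef := PosSemidef.one
    have h2' : (((2 ^ m : ℕ) : ℂ)⁻¹ • (1 : Matrix (Fin (2 ^ m)) (Fin (2 ^ m)) ℂ)).PosSemidef :=
      h2.smul (inv_nonneg.mpr (Nat.cast_nonneg _))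
    have h6 : (1 - (d : ℂ) • Matrix.kroneckerMap (· * ·) ρ
        (((2 ^ m : ℕ) : ℂ)⁻¹ • (1 : Matrix (Fin (2 ^ m)) (Fin (2 ^ m)) ℂ))).PosSemidef := by
      have h4 := (PurityCost.psd_iff hρ.1.1 ((2 ^ m : ℝ) / d)).mpr (fun i => by
        have := hlmax.2 ⟨i, rfl⟩
        rw [le_div_iff₀ hdR, mul_comm]
        exact (mul_le_mul_of_nonneg_left this hdR.le).trans hle)
      have h5 := h4.kronecker (h2'.smul (Nat.cast_nonneg (α := ℂ) d))
      have h7 : (1 - (d : ℂ) • Matrix.kroneckerMap (· * ·) ρ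
          (((2 ^ m : ℕ) : ℂ)⁻¹ • (1 : Matrix (Fin (2 ^ m)) (Fin (2 ^ m)) ℂ))) =
          Matrix.kroneckerMap (· * ·) (((((2 ^ m : ℝ) / d : ℝ)) : ℂ) • 1 - ρ)
            ((d : ℂ) • ((2 ^ m : ℕ) : ℂ)⁻¹ • (1 : Matrix (Fin (2 ^ m)) (Fin (2 ^ m)) ℂ)) := by
        ext ⟨i, j⟩ ⟨k, l⟩
        simp only [Matrix.sub_apply, Matrix.smul_apply, kroneckerMap_apply, one_apply,
          Prod.mk.injEq, smul_eq_mul]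
        by_cases hik : i = k <;> by_cases hjl : j = l <;> simp [hik, hjl] <;> field_simp
      rw [h7]
      exact h5
    obtain ⟨Λ, h₁, h₂, h₃⟩ := PurityCost.unital_exists
      (n := Fin d × Fin (2 ^ m)) (by simp [mul_comm]) _ a b (d : ℂ) c hdC
      (hρ.1.kronecker h2') ((trace_kronecker _ _).trans (by simp [hρ.2])) h6
    refine ⟨Λ, h₁, h₂, ?_⟩
    convert h₃ using 2
    ext ⟨i, j⟩ ⟨k, l⟩
    simp only [Matrix.smul_apply, kroneckerMap_apply, smul_eq_mul]
    ring
  · rintro m ⟨d₁, d₂, hd₁, hd₂, hdim, ψ, hψ, Λ, hΛ, hΛ1, hΛρ⟩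
    rw [PurityCost.toNat_ceil_le hpos]
    obtain ⟨a, b, -⟩ := hproj m d₁ ψ hψ
    set P := Matrix.kroneckerMap (· * ·) (kronPow (vecMulVec ψ (star ψ)) m)
        (1 : Matrix (Fin d₁) (Fin d₁) ℂ) with hPdef
    have hQpsd : (1 - P).PosSemidef := by
      have := posSemidef_conjTranspose_mul_self (1 - P)
      have e : (1 - P)ᴴ * (1 - P) = 1 - P := by
        simp [a, Matrix.mul_sub, Matrix.sub_mul, b]
      rwa [e] at this
    have h0 : (0 : ℂ) ≤ (d₁ : ℂ)⁻¹ := inv_nonneg.mpr (Nat.cast_nonneg _)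
    have h1 := PurityCost.channel_psd hΛ (hQpsd.smul h0)
    have e : (d₁ : ℂ)⁻¹ • (1 - P) = (d₁ : ℂ)⁻¹ • 1 -
        Matrix.kroneckerMap (· * ·) (kronPow (vecMulVec ψ (star ψ)) m)
                ((d₁ : ℂ)⁻¹ • (1 : Matrix (Fin d₁) (Fin d₁) ℂ)) := by
      rw [smul_sub]
      congr 1
      ext ⟨i, j⟩ ⟨k, l⟩
      simp only [hPdef, Matrix.smul_apply, kroneckerMap_apply, smul_eq_mul]
      ring
    rw [e, PurityCost.channel_smul_sub hΛ, hΛ1, hΛρ] at h1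
    have h2 := (h1.submatrix (fun i : Fin d => (i, (⟨0, hd₂⟩ : Fin d₂)))).smul
      (Nat.cast_nonneg (α := ℂ) d₂)
    have hd₁R : (0 : ℝ) < d₁ := by exact_mod_cast hd₁
    have hd₂C : (d₂ : ℂ) ≠ 0 := by exact_mod_cast hd₂.ne'
    have h3 : ((((d₂ : ℝ) / d₁ : ℝ) : ℂ) • (1 : Matrix (Fin d) (Fin d) ℂ) - ρ).PosSemidef := by
      convert h2 using 1
      ext i k
      simp only [Matrix.sub_apply, Matrix.smul_apply, kroneckerMap_apply, one_apply,
          Prod.mk.injEq, smul_eq_mul, submatrix_apply]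
      by_cases hik : i = k <;> simp [hik] <;> field_simp
    obtain ⟨i, hi⟩ := hlmax.1
    have h4 := (PurityCost.psd_iff hρ.1.1 _).mp h3 i
    rw [hi, le_div_iff₀ hd₁R] at h4
    have hdimR : (2 : ℝ) ^ m * d₁ = d * d₂ := by exact_mod_cast hdim
    refine le_of_mul_le_mul_right ?_ hd₁R
    rw [hdimR, mul_assoc]
    exact mul_le_mul_of_nonneg_left h4 hdR.le
end
end
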